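/- arXiv:hep-th/9409058 — 2 statements merged into one kernel-verified Lean document; each statement's English description precedes it below -/
import Mathlib

section
/- Let R′ be an n⁴ complex array which is of real type I, or of antireal type I. Then there is a (necessarily unique) conjugate-linear, antimultiplicative, unital bijection Φ: V(R′,R) → V̌(R′,R) with Φ(v^i) = x_i for all i = 1,…,n, and its inverse is the conjugate-linear, antimultiplicative, unital bijection Ψ: V̌(R′,R) → V(R′,R) with Ψ(x_i) = v^i for all i. -/
open scoped ComplexConjugate

noncomputable section

/-- An n⁴ array `R^i{}_j{}^k{}_l` viewed as an n²×n² matrix with row index `(i,k)`,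
column index `(j,l)`. -/
def toMat (n : ℕ) (R : Fin n → Fin n → Fin n → Fin n → ℂ) :
    Matrix (Fin n × Fin n) (Fin n × Fin n) ℂ :=
  Matrix.of fun p q => R p.1 q.1 p.2 q.2

/-- Entries `(R⁻¹)^i{}_j{}^k{}_l` of the matrix inverse of `R`. -/
def invEntry (n : ℕ) (R : Fin n → Fin n → Fin n → Fin n → ℂ)
    (i j k l : Fin n) : ℂ :=
  (toMat n R)⁻¹ (i, k) (j, l)

/-- `R` is of real type I: `conj (R^i{}_j{}^k{}_l) = R^l{}_k{}^j{}_i`. -/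
def RealTypeI (n : ℕ) (R : Fin n → Fin n → Fin n → Fin n → ℂ) : Prop :=
  ∀ i j k l, conj (R i j k l) = R l k j i

/-- `R` is of antireal type I: `R` invertible and
`conj (R^i{}_j{}^k{}_l) = (R⁻¹)^j{}_i{}^l{}_k`. -/
def AntirealTypeI (n : ℕ) (R : Fin n → Fin n → Fin n → Fin n → ℂ) : Prop :=
  IsUnit (toMat n R) ∧ ∀ i j k l, conj (R i j k l) = invEntry n R j i l k

/-- `R` is of real type II w.r.t. the involution `σ`:
`conj (R^i{}_j{}^k{}_l) = R^{σk}{}_{σl}{}^{σi}{}_{σj}`. -/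
def RealTypeII (n : ℕ) (R : Fin n → Fin n → Fin n → Fin n → ℂ)
    (σ : Fin n → Fin n) : Prop :=
  ∀ i j k l, conj (R i j k l) = R (σ k) (σ l) (σ i) (σ j)

/-- `R` is of antireal type II w.r.t. the involution `σ`: `R` invertible and
`conj (R^i{}_j{}^k{}_l) = (R⁻¹)^{σi}{}_{σj}{}^{σk}{}_{σl}`. -/
def AntirealTypeII (n : ℕ) (R : Fin n → Fin n → Fin n → Fin n → ℂ)
    (σ : Fin n → Fin n) : Prop :=
  IsUnit (toMat n R) ∧
    ∀ i j k l, conj (R i j k l) = invEntry n R (σ i) (σ j) (σ k) (σ l)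

/-- The metric `η` (entries `η^{ij} = η i j`) is `R`-covariant:
`Σ η^{ia} η^{jb} R^k{}_a{}^l{}_b = Σ R^i{}_a{}^j{}_b η^{ak} η^{bl}`. -/
def MetricCovariant (n : ℕ) (R : Fin n → Fin n → Fin n → Fin n → ℂ)
    (η : Matrix (Fin n) (Fin n) ℂ) : Prop :=
  ∀ i j k l, (∑ a : Fin n, ∑ b : Fin n, η i a * η j b * R k a l b) =
    ∑ a : Fin n, ∑ b : Fin n, R i a j b * η a k * η b l

/-- The metric `η` is real: `conj (η^{ij}) = η_{ji}`, where the lower-index entries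
`η_{ij}` are those of the transposed inverse, i.e. `η_{ji} = (η⁻¹) i j`. -/
def MetricReal (n : ℕ) (η : Matrix (Fin n) (Fin n) ℂ) : Prop :=
  ∀ i j, conj (η i j) = η⁻¹ i j

/-- The relations `x_i x_j = Σ_{a,b} R'^a{}_i{}^b{}_j x_b x_a` of the braided
covector algebra, as a relation on the free algebra. -/
inductive CovRel (n : ℕ) (R' : Fin n → Fin n → Fin n → Fin n → ℂ) :
    FreeAlgebra ℂ (Fin n) → FreeAlgebra ℂ (Fin n) → Prop
  | rel (i j : Fin n) :
      CovRel n R' (FreeAlgebra.ι ℂ i * FreeAlgebra.ι ℂ j)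
        (∑ a : Fin n, ∑ b : Fin n,
          R' a i b j • (FreeAlgebra.ι ℂ b * FreeAlgebra.ι ℂ a))

/-- The braided covector algebra `V̌(R',R)`: the free algebra on `x_1,…,x_n` modulo
the two-sided ideal generated by `x_i x_j − Σ R'^a{}_i{}^b{}_j x_b x_a`. -/
abbrev CovAlg (n : ℕ) (R' : Fin n → Fin n → Fin n → Fin n → ℂ) :=
  RingQuot (CovRel n R')

/-- The generator `x_i` of the braided covector algebra. -/
def xg (n : ℕ) (R' : Fin n → Fin n → Fin n → Fin n → ℂ) (i : Fin n) :
    CovAlg n R' :=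
  RingQuot.mkAlgHom ℂ (CovRel n R') (FreeAlgebra.ι ℂ i)

/-- The relations `v^i v^j = Σ_{a,b} R'^i{}_a{}^j{}_b v^b v^a` of the braided
vector algebra, as a relation on the free algebra. -/
inductive VecRel (n : ℕ) (R' : Fin n → Fin n → Fin n → Fin n → ℂ) :
    FreeAlgebra ℂ (Fin n) → FreeAlgebra ℂ (Fin n) → Prop
  | rel (i j : Fin n) :
      VecRel n R' (FreeAlgebra.ι ℂ i * FreeAlgebra.ι ℂ j)
        (∑ a : Fin n, ∑ b : Fin n,
          R' i a j b • (FreeAlgebra.ι ℂ b * FreeAlgebra.ι ℂ a))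

/-- The braided vector algebra `V(R',R)`: the free algebra on `v^1,…,v^n` modulo
the two-sided ideal generated by `v^i v^j − Σ R'^i{}_a{}^j{}_b v^b v^a`. -/
abbrev VecAlg (n : ℕ) (R' : Fin n → Fin n → Fin n → Fin n → ℂ) :=
  RingQuot (VecRel n R')

/-- The generator `v^i` of the braided vector algebra. -/
def vg (n : ℕ) (R' : Fin n → Fin n → Fin n → Fin n → ℂ) (i : Fin n) :
    VecAlg n R' :=
  RingQuot.mkAlgHom ℂ (VecRel n R') (FreeAlgebra.ι ℂ i)

/-- The relations of the braided tensor square of the braided covector algebra: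
generators `x_i = ι (inl i)`, `y_i = ι (inr i)`, with `x`- and `y`-relations from
`R'` and cross relations `y_i x_j = Σ_{a,b} R^a{}_i{}^b{}_j x_b y_a`. -/
inductive SqRel (n : ℕ) (R' R : Fin n → Fin n → Fin n → Fin n → ℂ) :
    FreeAlgebra ℂ (Fin n ⊕ Fin n) → FreeAlgebra ℂ (Fin n ⊕ Fin n) → Prop
  | xx (i j : Fin n) :
      SqRel n R' R (FreeAlgebra.ι ℂ (Sum.inl i) * FreeAlgebra.ι ℂ (Sum.inl j))
        (∑ a : Fin n, ∑ b : Fin n, R' a i b j •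
          (FreeAlgebra.ι ℂ (Sum.inl b) * FreeAlgebra.ι ℂ (Sum.inl a)))
  | yy (i j : Fin n) :
      SqRel n R' R (FreeAlgebra.ι ℂ (Sum.inr i) * FreeAlgebra.ι ℂ (Sum.inr j))
        (∑ a : Fin n, ∑ b : Fin n, R' a i b j •
          (FreeAlgebra.ι ℂ (Sum.inr b) * FreeAlgebra.ι ℂ (Sum.inr a)))
  | yx (i j : Fin n) :
      SqRel n R' R (FreeAlgebra.ι ℂ (Sum.inr i) * FreeAlgebra.ι ℂ (Sum.inl j))
        (∑ a : Fin n, ∑ b : Fin n, R a i b j •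
          (FreeAlgebra.ι ℂ (Sum.inl b) * FreeAlgebra.ι ℂ (Sum.inr a)))

/-- The braided tensor square `B` of the braided covector algebra. -/
abbrev SqAlg (n : ℕ) (R' R : Fin n → Fin n → Fin n → Fin n → ℂ) :=
  RingQuot (SqRel n R' R)

/-- The generator `x_i` of the braided tensor square. -/
def Xg (n : ℕ) (R' R : Fin n → Fin n → Fin n → Fin n → ℂ) (i : Fin n) :
    SqAlg n R' R :=
  RingQuot.mkAlgHom ℂ (SqRel n R' R) (FreeAlgebra.ι ℂ (Sum.inl i))

/-- The generator `y_i` of the braided tensor square. -/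
def Yg (n : ℕ) (R' R : Fin n → Fin n → Fin n → Fin n → ℂ) (i : Fin n) :
    SqAlg n R' R :=
  RingQuot.mkAlgHom ℂ (SqRel n R' R) (FreeAlgebra.ι ℂ (Sum.inr i))

/-- A conjugate-linear, antimultiplicative, unital map between ℂ-algebras. -/
def IsConjLinearAntiHom {A B : Type*} [Semiring A] [Algebra ℂ A]
    [Semiring B] [Algebra ℂ B] (f : A → B) : Prop :=
  (∀ a b : A, f (a + b) = f a + f b) ∧
  (∀ (c : ℂ) (a : A), f (c • a) = (starRingEnd ℂ) c • f a) ∧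
  (∀ a b : A, f (a * b) = f b * f a) ∧
  f 1 = 1

/-- A star structure on a ℂ-algebra: a conjugate-linear, antimultiplicative,
unital, involutive map. -/
def IsStarStructure {A : Type*} [Semiring A] [Algebra ℂ A] (f : A → A) : Prop :=
  (∀ a b : A, f (a + b) = f a + f b) ∧
  (∀ (c : ℂ) (a : A), f (c • a) = (starRingEnd ℂ) c • f a) ∧
  (∀ a b : A, f (a * b) = f b * f a) ∧
  f 1 = 1 ∧
  (∀ a : A, f (f a) = a)

/-- The opposite of a ℂ-algebra, with scalars acting through complex conjugation. -/
def ConjOp (A : Type*) := Aᵐᵒᵖ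

instance ConjOp.instSemiring (A : Type*) [Semiring A] : Semiring (ConjOp A) :=
  inferInstanceAs (Semiring Aᵐᵒᵖ)

instance ConjOp.instAlgebra (A : Type*) [Semiring A] [Algebra ℂ A] : Algebra ℂ (ConjOp A) :=
  ((algebraMap ℂ Aᵐᵒᵖ).comp (starRingEnd ℂ)).toAlgebra' fun c x =>
    Algebra.commutes (A := Aᵐᵒᵖ) (conj c) x

/-- The tautological additive bijection from `A` to `ConjOp A`. -/
def ConjOp.equiv (A : Type*) [Semiring A] : A ≃+ ConjOp A :=
  (MulOpposite.opAddEquiv : A ≃+ Aᵐᵒᵖ)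

theorem ConjOp.equiv_mul {A : Type*} [Semiring A] (a b : A) :
    ConjOp.equiv A (a * b) = ConjOp.equiv A b * ConjOp.equiv A a :=
  MulOpposite.op_mul a b

theorem ConjOp.equiv_one (A : Type*) [Semiring A] : ConjOp.equiv A 1 = 1 := rfl

theorem ConjOp.equiv_smul {A : Type*} [Semiring A] [Algebra ℂ A] (c : ℂ) (a : A) :
    ConjOp.equiv A (conj c • a) = c • ConjOp.equiv A a := by
  rw [Algebra.smul_def c]
  exact Algebra.smul_def (A := Aᵐᵒᵖ) (conj c) (MulOpposite.op a)

/-- A conjugate-linear antihomomorphism into `B` as an algebra map into `ConjOp B`. -/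
def IsConjLinearAntiHom.toAlgHom {A B : Type*} [Semiring A] [Algebra ℂ A]
    [Semiring B] [Algebra ℂ B] {f : A → B} (hf : IsConjLinearAntiHom f) : A →ₐ[ℂ] ConjOp B :=
  AlgHom.ofLinearMap
    { toFun := fun a => ConjOp.equiv B (f a)
      map_add' := fun a b => by rw [hf.1, map_add]
      map_smul' := fun c a => by rw [hf.2.1, ConjOp.equiv_smul]; rfl }
    (by simp [hf.2.2.2, ConjOp.equiv_one])
    (fun a b => by simp [hf.2.2.1, ConjOp.equiv_mul])

theorem IsConjLinearAntiHom.toAlgHom_apply {A B : Type*} [Semiring A] [Algebra ℂ A]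
    [Semiring B] [Algebra ℂ B] {f : A → B} (hf : IsConjLinearAntiHom f) (a : A) :
    hf.toAlgHom a = ConjOp.equiv B (f a) := rfl

/-- An algebra map into `ConjOp B` is a conjugate-linear antihomomorphism into `B`. -/
theorem isConjLinearAntiHom_of_algHom {A B : Type*} [Semiring A] [Algebra ℂ A]
    [Semiring B] [Algebra ℂ B] (F : A →ₐ[ℂ] ConjOp B) :
    IsConjLinearAntiHom fun a => (ConjOp.equiv B).symm (F a) := by
  refine ⟨fun a b => by simp, fun c a => ?_, fun a b => ?_, ?_⟩ <;>
    apply (ConjOp.equiv B).injective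
  · simp [ConjOp.equiv_smul]
  · simp [ConjOp.equiv_mul]
  · simp [ConjOp.equiv_one]

/-- The composite of two conjugate-linear antihomomorphisms is an algebra map. -/
def IsConjLinearAntiHom.compAlgHom {A B C : Type*} [Semiring A] [Algebra ℂ A]
    [Semiring B] [Algebra ℂ B] [Semiring C] [Algebra ℂ C] {g : B → C} {f : A → B}
    (hg : IsConjLinearAntiHom g) (hf : IsConjLinearAntiHom f) : A →ₐ[ℂ] C :=
  AlgHom.ofLinearMap
    { toFun := fun a => g (f a)
      map_add' := fun a b => by rw [hf.1, hg.1]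
      map_smul' := fun c a => by simp [hf.2.1, hg.2.1] }
    (by simp [hf.2.2.2, hg.2.2.2])
    (fun a b => by simp [hf.2.2.1, hg.2.2.1])

section Quotient

variable {X : Type*} {r : FreeAlgebra ℂ X → FreeAlgebra ℂ X → Prop}

theorem IsConjLinearAntiHom.ext_generators {B : Type*} [Semiring B] [Algebra ℂ B]
    {f g : RingQuot r → B} (hf : IsConjLinearAntiHom f) (hg : IsConjLinearAntiHom g)
    (h : ∀ x, f (RingQuot.mkAlgHom ℂ r (FreeAlgebra.ι ℂ x)) =
      g (RingQuot.mkAlgHom ℂ r (FreeAlgebra.ι ℂ x))) : f = g := by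
  have key : hf.toAlgHom = hg.toAlgHom := by
    apply RingQuot.ringQuot_ext'
    apply FreeAlgebra.hom_ext
    funext x
    exact congrArg (ConjOp.equiv B) (h x)
  funext a
  exact (ConjOp.equiv B).injective (DFunLike.congr_fun key a)

theorem IsConjLinearAntiHom.leftInverse_of_generators {B : Type*} [Semiring B] [Algebra ℂ B]
    {f : RingQuot r → B} {g : B → RingQuot r}
    (hg : IsConjLinearAntiHom g) (hf : IsConjLinearAntiHom f)
    (h : ∀ x, g (f (RingQuot.mkAlgHom ℂ r (FreeAlgebra.ι ℂ x))) =
      RingQuot.mkAlgHom ℂ r (FreeAlgebra.ι ℂ x)) : Function.LeftInverse g f := by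
  have key : hg.compAlgHom hf = AlgHom.id ℂ (RingQuot r) := by
    apply RingQuot.ringQuot_ext'
    apply FreeAlgebra.hom_ext
    funext x
    exact h x
  exact fun a => DFunLike.congr_fun key a

/-- Any assignment on generators compatible with the relations extends to a
conjugate-linear antihomomorphism on the quotient. -/
theorem exists_isConjLinearAntiHom {B : Type*} [Semiring B] [Algebra ℂ B] (g : X → B)
    (h : ∀ ⦃a b⦄, r a b → FreeAlgebra.lift ℂ (fun x => ConjOp.equiv B (g x)) a =
      FreeAlgebra.lift ℂ (fun x => ConjOp.equiv B (g x)) b) :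
    ∃ f : RingQuot r → B, IsConjLinearAntiHom f ∧
      ∀ x, f (RingQuot.mkAlgHom ℂ r (FreeAlgebra.ι ℂ x)) = g x := by
  refine ⟨_, isConjLinearAntiHom_of_algHom
    (RingQuot.liftAlgHom ℂ ⟨FreeAlgebra.lift ℂ (fun x => ConjOp.equiv B (g x)), h⟩), fun x => ?_⟩
  simp

end Quotient

section Relations

variable {n : ℕ} {R' : Fin n → Fin n → Fin n → Fin n → ℂ}

theorem xg_mul_xg (i j : Fin n) : xg n R' i * xg n R' j =
    ∑ a : Fin n, ∑ b : Fin n, R' a i b j • (xg n R' b * xg n R' a) := by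
  have := RingQuot.mkAlgHom_rel ℂ (CovRel.rel (R' := R') i j)
  simpa [xg] using this

theorem vg_mul_vg (i j : Fin n) : vg n R' i * vg n R' j =
    ∑ a : Fin n, ∑ b : Fin n, R' i a j b • (vg n R' b * vg n R' a) := by
  have := RingQuot.mkAlgHom_rel ℂ (VecRel.rel (R' := R') i j)
  simpa [vg] using this

/-- If `y = M x` for vectors `x`, `y` in a module and `M` is invertible, then `x = M⁻¹ y`. -/
theorem eq_sum_inv_smul {ι V : Type*} [Fintype ι] [DecidableEq ι] [AddCommMonoid V] [Module ℂ V]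
    {M : Matrix ι ι ℂ} (hM : IsUnit M) {x y : ι → V} (h : ∀ p, y p = ∑ q, M p q • x q) (p : ι) :
    x p = ∑ q, M⁻¹ p q • y q := by
  have hinv : M⁻¹ * M = 1 := Matrix.nonsing_inv_mul _ ((Matrix.isUnit_iff_isUnit_det _).1 hM)
  simp_rw [h, Finset.smul_sum, smul_smul]
  rw [Finset.sum_comm]
  simp_rw [← Finset.sum_smul, ← Matrix.mul_apply, hinv, Matrix.one_apply]
  simp

theorem xg_mul_xg_conj (hR' : RealTypeI n R' ∨ AntirealTypeI n R') (i j : Fin n) :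
    xg n R' j * xg n R' i =
      ∑ a : Fin n, ∑ b : Fin n, conj (R' i a j b) • (xg n R' a * xg n R' b) := by
  rcases hR' with h | ⟨hu, h⟩
  · unfold RealTypeI at h
    simp_rw [xg_mul_xg j i, h]
    exact Finset.sum_comm
  · have hu' : IsUnit (toMat n R').transpose := by
      rwa [Matrix.isUnit_transpose]
    have := eq_sum_inv_smul hu' (x := fun p => xg n R' p.2 * xg n R' p.1)
      (y := fun p => xg n R' p.1 * xg n R' p.2)
      (fun p => by simp [xg_mul_xg p.1 p.2, Fintype.sum_prod_type, toMat]) (i, j)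
    simpa [Fintype.sum_prod_type, h, invEntry, ← Matrix.transpose_nonsing_inv] using this

theorem vg_mul_vg_conj (hR' : RealTypeI n R' ∨ AntirealTypeI n R') (i j : Fin n) :
    vg n R' j * vg n R' i =
      ∑ a : Fin n, ∑ b : Fin n, conj (R' a i b j) • (vg n R' a * vg n R' b) := by
  rcases hR' with h | ⟨hu, h⟩
  · unfold RealTypeI at h
    simp_rw [vg_mul_vg j i, h]
    exact Finset.sum_comm
  · have := eq_sum_inv_smul hu (x := fun p => vg n R' p.2 * vg n R' p.1)
      (y := fun p => vg n R' p.1 * vg n R' p.2)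
      (fun p => by simp [vg_mul_vg p.1 p.2, Fintype.sum_prod_type, toMat]) (i, j)
    simpa [Fintype.sum_prod_type, h, invEntry] using this

end Relations

/-- if `R'` is of real or antireal type I, there is a unique
conjugate-linear, antimultiplicative, unital bijection `Φ : V(R',R) → V̌(R',R)`
with `Φ(v^i) = x_i`, and its inverse is the unique conjugate-linear,
antimultiplicative, unital bijection `Ψ : V̌(R',R) → V(R',R)` with `Ψ(x_i) = v^i`. -/
theorem stmt2 (n : ℕ) (hn : 1 ≤ n)
    (R R' : Fin n → Fin n → Fin n → Fin n → ℂ)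
    (hR' : RealTypeI n R' ∨ AntirealTypeI n R') :
    ∃! Φ : VecAlg n R' → CovAlg n R',
      (IsConjLinearAntiHom Φ ∧ Function.Bijective Φ ∧
        ∀ i : Fin n, Φ (vg n R' i) = xg n R' i) ∧
      ∃! Ψ : CovAlg n R' → VecAlg n R',
        (IsConjLinearAntiHom Ψ ∧ Function.Bijective Ψ ∧
          ∀ i : Fin n, Ψ (xg n R' i) = vg n R' i) ∧
        Function.LeftInverse Ψ Φ ∧ Function.RightInverse Ψ Φ := by
  obtain ⟨Φ, hΦ, hΦv⟩ : ∃ Φ : VecAlg n R' → CovAlg n R', IsConjLinearAntiHom Φ ∧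
      ∀ i, Φ (vg n R' i) = xg n R' i := by
    refine exists_isConjLinearAntiHom (xg n R') ?_
    rintro _ _ ⟨i, j⟩
    simp only [map_mul, map_sum, map_smul, FreeAlgebra.lift_ι_apply, ← ConjOp.equiv_mul,
      ← ConjOp.equiv_smul]
    rw [xg_mul_xg_conj hR']
    simp only [map_sum]
  obtain ⟨Ψ, hΨ, hΨx⟩ : ∃ Ψ : CovAlg n R' → VecAlg n R', IsConjLinearAntiHom Ψ ∧
      ∀ i, Ψ (xg n R' i) = vg n R' i := by
    refine exists_isConjLinearAntiHom (vg n R') ?_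
    rintro _ _ ⟨i, j⟩
    simp only [map_mul, map_sum, map_smul, FreeAlgebra.lift_ι_apply, ← ConjOp.equiv_mul,
      ← ConjOp.equiv_smul]
    rw [vg_mul_vg_conj hR']
    simp only [map_sum]
  have hl : Function.LeftInverse Ψ Φ :=
    hΨ.leftInverse_of_generators hΦ fun i => (congrArg Ψ (hΦv i)).trans (hΨx i)
  have hr : Function.RightInverse Ψ Φ :=
    hΦ.leftInverse_of_generators hΨ fun i => (congrArg Φ (hΨx i)).trans (hΦv i)
  refine ⟨Φ, ⟨⟨hΦ, ⟨hl.injective, hr.surjective⟩, hΦv⟩, Ψ,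
    ⟨⟨hΨ, ⟨hr.injective, hl.surjective⟩, hΨx⟩, hl, hr⟩, ?_⟩, ?_⟩
  · rintro Ψ' ⟨⟨hΨ', -, hΨx'⟩, -⟩
    exact hΨ'.ext_generators hΨ fun i => (hΨx' i).trans (hΨx i).symm
  · rintro Φ' ⟨⟨hΦ', -, hΦv'⟩, -⟩
    exact hΦ'.ext_generators hΦ fun i => (hΦv' i).trans (hΦv i).symm
end
end

section
/- Let R be an n⁴ complex array obeying the quantum Yang–Baxter equation and of real type I, and let η be an invertible n×n matrix that is R-covariant, with transposed-inverse entries η_{ij}. Then for every m ≥ 1 and all multi-indices, conj(([m;R]!)^{j_1⋯j_m}_{i_1⋯i_m}) = Σ_{a_1,…,a_m,b_1,…,b_m} ([m;R]!)^{a_m⋯a_1}_{b_m⋯b_1} η_{a_1 j_1} ⋯ η_{a_m j_m} η^{b_m i_m} ⋯ η^{b_1 i_1}. (This expresses that the duality pairing ⟨v^{j_m}⋯v^{j_1}, x_{i_1}⋯x_{i_m}⟩ = ([m;R]!)^{j_1⋯j_m}_{i_1⋯i_m} satisfies conj⟨b,c⟩ = ⟨b⋆,c*⟩ for the type I star structures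 (v^i)⋆ = Σ_a v^a η_{ai} and x_i* = Σ_a x_a η^{ai}.) -/
open scoped ComplexConjugate

noncomputable section

/-- The matrix `PR` on ℂⁿ⊗ℂⁿ: `(PR)^i{}_j{}^k{}_l = R^k{}_j{}^i{}_l`. -/
def PRmat (n : ℕ) (R : Fin n → Fin n → Fin n → Fin n → ℂ) :
    Matrix (Fin n × Fin n) (Fin n × Fin n) ℂ :=
  Matrix.of fun p q => R p.2 q.1 p.1 q.2

/-- The matrix `A_{k+1,k+2}` on `(ℂⁿ)^{⊗m}` acting as the two-site matrix `A` in the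
(0-indexed) tensor factors `k, k+1` and as the identity elsewhere (the identity
matrix if `k+1 ≥ m`). -/
def site (n m : ℕ) (A : Matrix (Fin n × Fin n) (Fin n × Fin n) ℂ) (k : ℕ) :
    Matrix (Fin m → Fin n) (Fin m → Fin n) ℂ :=
  if h : k + 1 < m then
    Matrix.of fun f g =>
      A (f ⟨k, Nat.lt_of_succ_lt h⟩, f ⟨k + 1, h⟩)
        (g ⟨k, Nat.lt_of_succ_lt h⟩, g ⟨k + 1, h⟩) *
      ∏ t : Fin m,
        (if t.1 = k ∨ t.1 = k + 1 then (1 : ℂ) else if f t = g t then 1 else 0)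
  else 1

/-- The ordered product `A_{off+1,off+2} A_{off+2,off+3} ⋯ A_{off+r,off+r+1}`
(1-indexed tensor positions) on `(ℂⁿ)^{⊗m}`; the identity for `r = 0`. -/
def chain (n m : ℕ) (A : Matrix (Fin n × Fin n) (Fin n × Fin n) ℂ)
    (off r : ℕ) : Matrix (Fin m → Fin n) (Fin m → Fin n) ℂ :=
  ((List.range r).map fun s => site n m A (off + s)).prod

/-- The reversed ordered product `A_{off+r,off+r+1} ⋯ A_{off+2,off+3} A_{off+1,off+2}`
on `(ℂⁿ)^{⊗m}`; the identity for `r = 0`. -/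
def chainOp (n m : ℕ) (A : Matrix (Fin n × Fin n) (Fin n × Fin n) ℂ)
    (off r : ℕ) : Matrix (Fin m → Fin n) (Fin m → Fin n) ℂ :=
  (((List.range r).reverse).map fun s => site n m A (off + s)).prod

/-- The braided integer `[k;R]` acting in the tensor factors `off+1,…,off+k`
(1-indexed) of `(ℂⁿ)^{⊗m}`:
`[k;R] = Σ_{r=0}^{k−1} (PR)_{12}(PR)_{23}⋯(PR)_{r,r+1}` (shifted by `off`). -/
def braidedInt (n m : ℕ) (R : Fin n → Fin n → Fin n → Fin n → ℂ)
    (off k : ℕ) : Matrix (Fin m → Fin n) (Fin m → Fin n) ℂ :=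
  ∑ r ∈ Finset.range k, chain n m (PRmat n R) off r

/-- The opposite braided integer `[k;R]^{op}` acting in the tensor factors
`off+1,…,off+k` of `(ℂⁿ)^{⊗m}`:
`[k;R]^{op} = Σ_{r=0}^{k−1} (PR)_{r,r+1}⋯(PR)_{23}(PR)_{12}` (shifted by `off`). -/
def braidedIntOp (n m : ℕ) (R : Fin n → Fin n → Fin n → Fin n → ℂ)
    (off k : ℕ) : Matrix (Fin m → Fin n) (Fin m → Fin n) ℂ :=
  ∑ r ∈ Finset.range k, chainOp n m (PRmat n R) off r

/-- The braided factorial `[m;R]! = [2;R]_{m−1,m} [3;R]_{m−2,…,m} ⋯ [m;R]_{1,…,m}`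
on `(ℂⁿ)^{⊗m}`. -/
def braidedFact (n m : ℕ) (R : Fin n → Fin n → Fin n → Fin n → ℂ) :
    Matrix (Fin m → Fin n) (Fin m → Fin n) ℂ :=
  ((List.range (m - 1)).map fun t => braidedInt n m R (m - (t + 2)) (t + 2)).prod

/-- The opposite braided factorial
`[m;R]^{op}! = [m;R]^{op}_{1,…,m} ⋯ [3;R]^{op}_{m−2,…,m} [2;R]^{op}_{m−1,m}`. -/
def braidedFactOp (n m : ℕ) (R : Fin n → Fin n → Fin n → Fin n → ℂ) :
    Matrix (Fin m → Fin n) (Fin m → Fin n) ℂ :=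
  (((List.range (m - 1)).reverse).map fun t =>
    braidedIntOp n m R (m - (t + 2)) (t + 2)).prod

/-- `R₁₂` on ℂⁿ⊗ℂⁿ⊗ℂⁿ. -/
def Rmat12 (n : ℕ) (R : Fin n → Fin n → Fin n → Fin n → ℂ) :
    Matrix (Fin n × Fin n × Fin n) (Fin n × Fin n × Fin n) ℂ :=
  Matrix.of fun p q =>
    R p.1 q.1 p.2.1 q.2.1 * (if p.2.2 = q.2.2 then 1 else 0)

/-- `R₁₃` on ℂⁿ⊗ℂⁿ⊗ℂⁿ. -/
def Rmat13 (n : ℕ) (R : Fin n → Fin n → Fin n → Fin n → ℂ) :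
    Matrix (Fin n × Fin n × Fin n) (Fin n × Fin n × Fin n) ℂ :=
  Matrix.of fun p q =>
    R p.1 q.1 p.2.2 q.2.2 * (if p.2.1 = q.2.1 then 1 else 0)

/-- `R₂₃` on ℂⁿ⊗ℂⁿ⊗ℂⁿ. -/
def Rmat23 (n : ℕ) (R : Fin n → Fin n → Fin n → Fin n → ℂ) :
    Matrix (Fin n × Fin n × Fin n) (Fin n × Fin n × Fin n) ℂ :=
  Matrix.of fun p q =>
    (if p.1 = q.1 then (1 : ℂ) else 0) * R p.2.1 q.2.1 p.2.2 q.2.2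

/-- The quantum Yang–Baxter equation `R₁₂R₁₃R₂₃ = R₂₃R₁₃R₁₂`. -/
def QYBE (n : ℕ) (R : Fin n → Fin n → Fin n → Fin n → ℂ) : Prop :=
  Rmat12 n R * Rmat13 n R * Rmat23 n R = Rmat23 n R * Rmat13 n R * Rmat12 n R

/-- The array `R₂₁`, with `R₂₁^i{}_j{}^k{}_l = R^k{}_l{}^i{}_j`. -/
def swapR (n : ℕ) (R : Fin n → Fin n → Fin n → Fin n → ℂ) :
    Fin n → Fin n → Fin n → Fin n → ℂ :=
  fun i j k l => R k l i j

section BraidWords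

variable {A : Type*} [Ring A]

/-- The ascending sum `1 + b 0 + b 0 * b 1 + ⋯` with longest term `b 0 * ⋯ * b (s - 1)`. -/
def ascSum (b : ℕ → A) (s : ℕ) : A :=
  ∑ r ∈ Finset.range (s + 1), ((List.range r).map b).prod

/-- The descending sum `1 + b s + b s * b (s - 1) + ⋯` with longest term `b s * ⋯ * b 0`. -/
def descSum (b : ℕ → A) (s : ℕ) : A :=
  ∑ r ∈ Finset.range (s + 2), ((List.range r).map fun u => b (s - u)).prod

/-- The braided factorial in the generators `b 0, …, b (s - 1)`, built from ascending sums. -/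
def ascFact : (ℕ → A) → ℕ → A
  | _, 0 => 1
  | b, s + 1 => ascFact (fun k => b (k + 1)) s * ascSum b (s + 1)

/-- The braided factorial in the generators `b 0, …, b (s - 1)`, built from descending sums. -/
def descFact (b : ℕ → A) : ℕ → A
  | 0 => 1
  | s + 1 => descFact b s * descSum b s

theorem prod_map_range_succ (b : ℕ → A) (r : ℕ) :
    ((List.range (r + 1)).map b).prod = ((List.range r).map b).prod * b r := by
  simp [List.range_succ]

theorem sum_range_succ_eq_sum_ite {M : Type*} [AddCommMonoid M] (f : ℕ → M) {k n : ℕ}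
    (hk : k < n) :
    ∑ l ∈ Finset.range (n + 1), f l =
      ∑ l ∈ Finset.range n,
        ((if l ≤ k then f l else 0) + (if k ≤ l then f (l + 1) else 0)) := by
  induction n with
  | zero => omega
  | succ n ih =>
    rcases Nat.lt_succ_iff_lt_or_eq.mp hk with h | rfl
    · rw [Finset.sum_range_succ, ih h, Finset.sum_range_succ _ n]
      simp [h.le, Nat.not_le.mpr h]
    · rw [Finset.sum_range_succ, Finset.sum_add_distrib]
      congr 1
      · refine Finset.sum_congr rfl fun l hl => ?_
        rw [if_pos (Nat.lt_succ_iff.mp (Finset.mem_range.mp hl))]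
      · rw [Finset.sum_range_succ, Finset.sum_eq_zero, if_pos le_rfl, zero_add]
        intro l hl
        rw [if_neg (Nat.not_le.mpr (Finset.mem_range.mp hl))]

section Descending

variable {b d : ℕ → A} {T : ℕ}

theorem commute_descending (hc : ∀ i j, i + 1 < j → Commute (b i) (b j))
    (hT : d (T + 1) = 1) (hd : ∀ k ≤ T, d k = d (k + 1) * b k)
    {j k : ℕ} (hk : k ≤ T + 1) (hj : j + 1 < k) : Commute (d k) (b j) := by
  induction hk using Nat.decreasingInduction with
  | self => rw [hT]; exact Commute.one_left _
  | of_succ k hk ih =>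
    rw [hd k (by omega)]
    exact (ih (by omega)).mul_left (hc j k hj).symm

theorem descending_mul (hc : ∀ i j, i + 1 < j → Commute (b i) (b j))
    (hb : ∀ i < T, b i * b (i + 1) * b i = b (i + 1) * b i * b (i + 1))
    (hT : d (T + 1) = 1) (hd : ∀ k ≤ T, d k = d (k + 1) * b k)
    {k l : ℕ} (hk : k ≤ l) (hl : l < T) : d k * b (l + 1) = b l * d k := by
  induction hk using Nat.decreasingInduction with
  | self =>
    have h := (commute_descending hc hT hd (j := l) (k := l + 2) (by omega) (by omega)).eq
    rw [hd l hl.le, hd (l + 1) hl]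
    calc d (l + 2) * b (l + 1) * b l * b (l + 1)
        = d (l + 2) * (b (l + 1) * b l * b (l + 1)) := by noncomm_ring
      _ = d (l + 2) * b l * b (l + 1) * b l := by rw [← hb l hl]; noncomm_ring
      _ = b l * (d (l + 2) * b (l + 1) * b l) := by rw [h]; noncomm_ring
  | of_succ k hk ih =>
    rw [hd k (by omega), mul_assoc, (hc k (l + 1) (by omega)).eq, ← mul_assoc, ih, mul_assoc]

theorem commute_descending_prod (hc : ∀ i j, i + 1 < j → Commute (b i) (b j))
    (hT : d (T + 1) = 1) (hd : ∀ k ≤ T, d k = d (k + 1) * b k)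
    {k l : ℕ} (hk : k ≤ T + 1) (hl : l < k) :
    Commute (d k) ((List.range l).map b).prod := by
  induction l with
  | zero => simp
  | succ l ih =>
    rw [prod_map_range_succ]
    exact (ih (by omega)).mul_right (commute_descending hc hT hd hk hl)

theorem descending_mul_prod (hc : ∀ i j, i + 1 < j → Commute (b i) (b j))
    (hb : ∀ i < T, b i * b (i + 1) * b i = b (i + 1) * b i * b (i + 1))
    (hT : d (T + 1) = 1) (hd : ∀ k ≤ T, d k = d (k + 1) * b k)
    {k l : ℕ} (hk : k ≤ l) (hl : l ≤ T) :
    d (k + 1) * ((List.range (l + 1)).map b).prod = ((List.range l).map b).prod * d k := by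
  induction l, hk using Nat.le_induction with
  | base =>
    rw [prod_map_range_succ, ← mul_assoc,
      (commute_descending_prod hc hT hd (by omega) (Nat.lt_succ_self k)).eq, hd k hl, mul_assoc]
  | succ l hk ih =>
    rw [prod_map_range_succ, ← mul_assoc, ih (by omega), mul_assoc,
      descending_mul hc hb hT hd hk (by omega), prod_map_range_succ _ l, mul_assoc]

theorem sum_descending_mul_ascSum (hc : ∀ i j, i + 1 < j → Commute (b i) (b j))
    (hb : ∀ i < T, b i * b (i + 1) * b i = b (i + 1) * b i * b (i + 1))
    (hT : d (T + 1) = 1) (hd : ∀ k ≤ T, d k = d (k + 1) * b k) :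
    (∑ k ∈ Finset.range (T + 1), d (k + 1)) * ascSum b (T + 1) =
      ascSum b T * ∑ k ∈ Finset.range (T + 2), d k := by
  simp only [ascSum]
  rw [Finset.sum_mul_sum, Finset.sum_mul_sum]
  trans ∑ k ∈ Finset.range (T + 1), ∑ l ∈ Finset.range (T + 1),
    ((if l ≤ k then ((List.range l).map b).prod * d (k + 1) else 0) +
      (if k ≤ l then ((List.range l).map b).prod * d k else 0))
  · refine Finset.sum_congr rfl fun k hk => ?_
    have hk' := Finset.mem_range.mp hk
    rw [sum_range_succ_eq_sum_ite _ hk']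
    refine Finset.sum_congr rfl fun l hl => ?_
    have hl' := Finset.mem_range.mp hl
    congr 1
    · split_ifs with h
      · exact (commute_descending_prod hc hT hd (by omega) (by omega)).eq
      · rfl
    · split_ifs with h
      · exact descending_mul_prod hc hb hT hd h (by omega)
      · rfl
  · rw [Finset.sum_comm]
    refine Finset.sum_congr rfl fun l hl => ?_
    rw [sum_range_succ_eq_sum_ite _ (Finset.mem_range.mp hl)]
    exact Finset.sum_congr rfl fun k _ => add_comm _ _

end Descending

theorem descSum_shift_mul_ascSum {b : ℕ → A} (s : ℕ)
    (hc : ∀ i j, i + 1 < j → Commute (b i) (b j))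
    (hb : ∀ i < s + 1, b i * b (i + 1) * b i = b (i + 1) * b i * b (i + 1)) :
    descSum (fun k => b (k + 1)) s * ascSum b (s + 2) = ascSum b (s + 1) * descSum b (s + 1) := by
  let d : ℕ → A := fun k => ((List.range (s + 2 - k)).map fun u => b (s + 1 - u)).prod
  have hT : d (s + 1 + 1) = 1 := by simp [d]
  have hd : ∀ k ≤ s + 1, d k = d (k + 1) * b k := by
    intro k hk
    simp only [d]
    rw [show s + 2 - k = (s + 2 - (k + 1)) + 1 by omega, prod_map_range_succ]
    congr 2
    omega
  have h₁ : descSum (fun k => b (k + 1)) s = ∑ k ∈ Finset.range (s + 1 + 1), d (k + 1) := by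
    rw [descSum, ← Finset.sum_range_reflect]
    refine Finset.sum_congr rfl fun k hk => ?_
    have hk' := Finset.mem_range.mp hk
    simp only [d]
    rw [show s + 2 - (k + 1) = s + 2 - 1 - k by omega]
    congr 1
    refine List.map_congr_left fun u hu => ?_
    have := List.mem_range.mp hu
    congr 1
    omega
  have h₂ : descSum b (s + 1) = ∑ k ∈ Finset.range (s + 1 + 2), d k := by
    rw [descSum, ← Finset.sum_range_reflect]
    refine Finset.sum_congr rfl fun k hk => ?_
    simp only [d]
    rw [show s + 1 + 2 - 1 - k = s + 2 - k by omega]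
  rw [h₁, h₂]
  exact sum_descending_mul_ascSum hc hb hT hd

theorem ascFact_eq_descFact (N : ℕ) (b : ℕ → A)
    (hc : ∀ i j, i + 1 < j → Commute (b i) (b j))
    (hb : ∀ i, i + 1 < N → b i * b (i + 1) * b i = b (i + 1) * b i * b (i + 1)) :
    ascFact b N = descFact b N := by
  induction N using Nat.strong_induction_on generalizing b with
  | _ N ih =>
    match N with
    | 0 => rfl
    | 1 => simp [ascFact, descFact, ascSum, descSum, Finset.sum_range_succ]
    | s + 2 =>
      have hc' : ∀ i j, i + 1 < j → Commute (b (i + 1)) (b (j + 1)) :=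
        fun i j h => hc _ _ (by omega)
      rw [ascFact, descFact, ih (s + 1) (by omega) _ hc' fun i h => hb (i + 1) (by omega),
        ← ih (s + 1) (by omega) b hc fun i h => hb i (by omega), descFact, ascFact, mul_assoc,
        mul_assoc, descSum_shift_mul_ascSum s hc fun i h => hb i (by omega),
        ih s (by omega) _ hc' fun i h => hb (i + 1) (by omega)]

theorem ascSum_congr {b c : ℕ → A} {N : ℕ} (h : ∀ k < N, b k = c k) :
    ascSum b N = ascSum c N := by
  refine Finset.sum_congr rfl fun r hr => ?_
  congr 1
  refine List.map_congr_left fun u hu => h u ?_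
  have := List.mem_range.mp hu
  have := Finset.mem_range.mp hr
  omega

theorem ascFact_congr {b c : ℕ → A} {N : ℕ} (h : ∀ k < N, b k = c k) :
    ascFact b N = ascFact c N := by
  induction N generalizing b c with
  | zero => rfl
  | succ N ih =>
    rw [ascFact, ascFact, ascSum_congr h, ih fun k hk => h (k + 1) (by omega)]

theorem ascFact_reverse (N : ℕ) (b : ℕ → A) :
    ascFact (fun k => b (N - 1 - k)) N = descFact b N := by
  induction N with
  | zero => rfl
  | succ N ih =>
    rw [ascFact, descFact, ← ih]
    congr 1
    exact ascFact_congr fun k _ => by congr 1; omega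

theorem map_ascFact {A' : Type*} [Ring A'] (φ : A →+* A') (b : ℕ → A) (N : ℕ) :
    φ (ascFact b N) = ascFact (fun k => φ (b k)) N := by
  induction N generalizing b with
  | zero => simp [ascFact]
  | succ N ih =>
    rw [ascFact, ascFact, map_mul, ih, ascSum, ascSum, map_sum]
    simp [map_list_prod, Function.comp_def]

theorem semiconjBy_ascFact {S : A} {x y : ℕ → A} {N : ℕ}
    (h : ∀ k < N, SemiconjBy S (x k) (y k)) : SemiconjBy S (ascFact x N) (ascFact y N) := by
  induction N generalizing x y with
  | zero => exact SemiconjBy.one_right S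
  | succ N ih =>
    refine (ih fun k hk => h (k + 1) (by omega)).mul_right ?_
    have hprod : ∀ r ≤ N + 1, SemiconjBy S ((List.range r).map x).prod
        ((List.range r).map y).prod := by
      intro r hr
      induction r with
      | zero => simp
      | succ r ihr =>
        rw [prod_map_range_succ, prod_map_range_succ]
        exact (ihr (by omega)).mul_right (h r (by omega))
    simp only [SemiconjBy, ascSum, Finset.mul_sum, Finset.sum_mul]
    exact Finset.sum_congr rfl fun r hr => hprod r (by have := Finset.mem_range.mp hr; omega)

theorem prod_ascSum_eq_ascFact (b : ℕ → A) {N s : ℕ} (hs : s ≤ N) :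
    ((List.range s).map fun t =>
      ∑ r ∈ Finset.range (t + 2), ((List.range r).map fun u => b (N - (t + 1) + u)).prod).prod =
      ascFact (fun k => b (N - s + k)) s := by
  induction s with
  | zero => rfl
  | succ s ih =>
    rw [prod_map_range_succ, ih (by omega), ascFact, ascSum]
    congr 1
    exact ascFact_congr fun k _ => by congr 1; omega

end BraidWords

section Site

variable {n m : ℕ}

/-- The multi-index `f` with the entries in places `k`, `k + 1` replaced by `p`. -/
def replacePair (f : Fin m → Fin n) (k : ℕ) (p : Fin n × Fin n) : Fin m → Fin n :=
  fun t => if t.1 = k then p.1 else if t.1 = k + 1 then p.2 else f t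

theorem site_apply (A : Matrix (Fin n × Fin n) (Fin n × Fin n) ℂ) {k : ℕ} (h : k + 1 < m)
    (f g : Fin m → Fin n) :
    site n m A k f g =
      A (f ⟨k, Nat.lt_of_succ_lt h⟩, f ⟨k + 1, h⟩) (g ⟨k, Nat.lt_of_succ_lt h⟩, g ⟨k + 1, h⟩) *
      ∏ t : Fin m, (if t.1 = k ∨ t.1 = k + 1 then (1 : ℂ) else if f t = g t then 1 else 0) := by
  rw [site, dif_pos h, Matrix.of_apply]

theorem site_transpose (A : Matrix (Fin n × Fin n) (Fin n × Fin n) ℂ) (k : ℕ) :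
    (site n m A k).transpose = site n m A.transpose k := by
  by_cases h : k + 1 < m
  · ext f g
    rw [Matrix.transpose_apply, site_apply A h, site_apply _ h, Matrix.transpose_apply]
    simp only [eq_comm]
  · simp [site, h]

theorem site_map_conj (A : Matrix (Fin n × Fin n) (Fin n × Fin n) ℂ) (k : ℕ) :
    (starRingEnd ℂ).mapMatrix (site n m A k) = site n m (A.map (starRingEnd ℂ)) k := by
  by_cases h : k + 1 < m
  · ext f g
    rw [RingHom.mapMatrix_apply, Matrix.map_apply, site_apply A h, site_apply _ h,
      Matrix.map_apply, map_mul, map_prod]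
    simp only [apply_ite (starRingEnd ℂ), map_one, map_zero]
  · simp [site, h]

theorem sum_site_mul (A : Matrix (Fin n × Fin n) (Fin n × Fin n) ℂ) {k : ℕ} (h : k + 1 < m)
    (f : Fin m → Fin n) (φ : (Fin m → Fin n) → ℂ) :
    ∑ g, site n m A k f g * φ g =
      ∑ p, A (f ⟨k, Nat.lt_of_succ_lt h⟩, f ⟨k + 1, h⟩) p * φ (replacePair f k p) := by
  have hprod : ∀ g : Fin m → Fin n,
      (∏ t : Fin m, (if t.1 = k ∨ t.1 = k + 1 then (1 : ℂ) else if f t = g t then 1 else 0)) =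
        if ∀ t : Fin m, ¬(t.1 = k ∨ t.1 = k + 1) → f t = g t then 1 else 0 := by
    intro g
    split_ifs with hg
    · refine Finset.prod_eq_one fun t _ => ?_
      split_ifs with h₁ h₂
      · rfl
      · rfl
      · exact absurd (hg t h₁) h₂
    · push Not at hg
      obtain ⟨t, h₁, h₂⟩ := hg
      refine Finset.prod_eq_zero (Finset.mem_univ t) ?_
      rw [if_neg (by tauto), if_neg h₂]
  have hrepl : ∀ g : Fin m → Fin n, (∀ t : Fin m, ¬(t.1 = k ∨ t.1 = k + 1) → f t = g t) →
      replacePair f k (g ⟨k, Nat.lt_of_succ_lt h⟩, g ⟨k + 1, h⟩) = g := by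
    intro g hg
    funext t
    simp only [replacePair]
    split_ifs with h₁ h₂
    · exact congrArg g (Fin.ext h₁.symm)
    · exact congrArg g (Fin.ext h₂.symm)
    · exact hg t (by tauto)
  simp only [site_apply A h, hprod, mul_ite, mul_one, mul_zero, ite_mul, zero_mul]
  rw [← Finset.sum_filter]
  refine Finset.sum_nbij' (fun g => (g ⟨k, Nat.lt_of_succ_lt h⟩, g ⟨k + 1, h⟩))
    (replacePair f k) ?_ ?_ ?_ ?_ ?_
  · simp
  · intro p _
    simp only [Finset.mem_filter, Finset.mem_univ, true_and, replacePair]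
    intro t ht
    rw [if_neg (by tauto), if_neg (by tauto)]
  · intro g hg
    exact hrepl g fun t ht => by simpa using (Finset.mem_filter.mp hg).2 t ht
  · intro p _
    simp [replacePair]
  · intro g hg
    rw [hrepl g fun t ht => by simpa using (Finset.mem_filter.mp hg).2 t ht]

theorem site_mul_apply (A : Matrix (Fin n × Fin n) (Fin n × Fin n) ℂ) {k : ℕ} (h : k + 1 < m)
    (M : Matrix (Fin m → Fin n) (Fin m → Fin n) ℂ) (f g : Fin m → Fin n) :
    (site n m A k * M) f g =
      ∑ p, A (f ⟨k, Nat.lt_of_succ_lt h⟩, f ⟨k + 1, h⟩) p * M (replacePair f k p) g := by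
  rw [Matrix.mul_apply, sum_site_mul A h f fun f' => M f' g]

theorem mul_site_apply (A : Matrix (Fin n × Fin n) (Fin n × Fin n) ℂ) {k : ℕ} (h : k + 1 < m)
    (M : Matrix (Fin m → Fin n) (Fin m → Fin n) ℂ) (f g : Fin m → Fin n) :
    (M * site n m A k) f g =
      ∑ p, M f (replacePair g k p) * A p (g ⟨k, Nat.lt_of_succ_lt h⟩, g ⟨k + 1, h⟩) := by
  rw [← Matrix.transpose_apply (M * site n m A k), Matrix.transpose_mul, site_transpose,
    site_mul_apply _ h]
  simp [mul_comm]

theorem site_commute (A : Matrix (Fin n × Fin n) (Fin n × Fin n) ℂ) {k l : ℕ} (hkl : k + 1 < l) :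
    Commute (site n m A k) (site n m A l) := by
  by_cases hl : l + 1 < m
  · have hk : k + 1 < m := by omega
    have key : ∀ M : Matrix (Fin m → Fin n) (Fin m → Fin n) ℂ,
        site n m A k * (site n m A l * M) = site n m A l * (site n m A k * M) := by
      intro M
      ext f g
      simp only [site_mul_apply A hk, site_mul_apply A hl, Finset.mul_sum]
      rw [Finset.sum_comm]
      refine Finset.sum_congr rfl fun p _ => Finset.sum_congr rfl fun q _ => ?_
      have hcomm : replacePair (replacePair f k q) l p = replacePair (replacePair f l p) k q := by
        ext t
        simp only [replacePair]
        grind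
      have h₁ : k ≠ l := by omega
      have h₂ : k ≠ l + 1 := by omega
      have h₃ : k + 1 ≠ l := by omega
      have h₄ : k + 1 ≠ l + 1 := by omega
      rw [hcomm]
      simp only [replacePair, h₁, h₂, h₃, h₄, h₁.symm, h₂.symm, h₃.symm, h₄.symm, if_false]
      ring
    simpa [Commute, SemiconjBy] using key 1
  · simp [site, hl]

theorem QYBE.sum_eq {R : Fin n → Fin n → Fin n → Fin n → ℂ} (hR : QYBE n R)
    (i₁ i₂ i₃ j₁ j₂ j₃ : Fin n) :
    ∑ a, ∑ b, ∑ c, R i₁ a i₂ b * R a j₁ i₃ c * R b j₂ c j₃ =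
      ∑ a, ∑ b, ∑ c, R i₂ a i₃ b * R i₁ c b j₃ * R c j₁ a j₂ := by
  have h := congrFun (congrFun hR (i₁, i₂, i₃)) (j₁, j₂, j₃)
  rw [Matrix.mul_assoc, Matrix.mul_assoc] at h
  simp only [Matrix.mul_apply, Fintype.sum_prod_type, Rmat12, Rmat13, Rmat23, Matrix.of_apply,
    mul_ite, mul_one, mul_zero, ite_mul, one_mul, zero_mul, Finset.sum_ite_eq,
    Finset.sum_ite_eq', Finset.mem_univ, if_true, Finset.sum_ite_irrel,
    Finset.sum_const_zero] at h
  simpa only [Finset.mul_sum, ← mul_assoc] using h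

theorem sum_six_reorder_left {α : Type*} [Fintype α] (F : α → α → α → α → α → α → ℂ) :
    ∑ p, ∑ q, ∑ r, ∑ s, ∑ t, ∑ u, F p q r s t u =
      ∑ t, ∑ u, ∑ s, ∑ p, ∑ q, ∑ r, F p q r s t u := by
  let e : α × α × α × α × α × α ≃ α × α × α × α × α × α :=
    { toFun := fun ⟨p, q, r, s, t, u⟩ => ⟨t, u, s, p, q, r⟩
      invFun := fun ⟨t, u, s, p, q, r⟩ => ⟨p, q, r, s, t, u⟩
      left_inv := fun _ => rfl
      right_inv := fun _ => rfl }
  have h := Fintype.sum_equiv e (fun ⟨p, q, r, s, t, u⟩ => F p q r s t u)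
    (fun ⟨t, u, s, p, q, r⟩ => F p q r s t u) fun _ => rfl
  simpa only [Fintype.sum_prod_type] using h

theorem sum_six_reorder_right {α : Type*} [Fintype α] (F : α → α → α → α → α → α → ℂ) :
    ∑ p, ∑ q, ∑ r, ∑ s, ∑ t, ∑ u, F p q r s t u =
      ∑ r, ∑ t, ∑ u, ∑ p, ∑ q, ∑ s, F p q r s t u := by
  let e : α × α × α × α × α × α ≃ α × α × α × α × α × α :=
    { toFun := fun ⟨p, q, r, s, t, u⟩ => ⟨r, t, u, p, q, s⟩
      invFun := fun ⟨r, t, u, p, q, s⟩ => ⟨p, q, r, s, t, u⟩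
      left_inv := fun _ => rfl
      right_inv := fun _ => rfl }
  have h := Fintype.sum_equiv e (fun ⟨p, q, r, s, t, u⟩ => F p q r s t u)
    (fun ⟨r, t, u, p, q, s⟩ => F p q r s t u) fun _ => rfl
  simpa only [Fintype.sum_prod_type] using h

theorem site_braid {R : Fin n → Fin n → Fin n → Fin n → ℂ} (hR : QYBE n R) {k : ℕ}
    (h : k + 2 < m) :
    site n m (PRmat n R) k * site n m (PRmat n R) (k + 1) * site n m (PRmat n R) k =
      site n m (PRmat n R) (k + 1) * site n m (PRmat n R) k * site n m (PRmat n R) (k + 1) := by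
  have hk : k + 1 < m := by omega
  have hk' : k + 1 + 1 < m := h
  have key : ∀ M : Matrix (Fin m → Fin n) (Fin m → Fin n) ℂ,
      site n m (PRmat n R) k * (site n m (PRmat n R) (k + 1) * (site n m (PRmat n R) k * M)) =
        site n m (PRmat n R) (k + 1) *
          (site n m (PRmat n R) k * (site n m (PRmat n R) (k + 1) * M)) := by
    intro M
    ext f g
    let τ : Fin n → Fin n → Fin n → Fin m → Fin n := fun a b c t =>
      if t.1 = k then a else if t.1 = k + 1 then b else if t.1 = k + 2 then c else f t
    have hτ : ∀ p q r s t u,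
        replacePair (replacePair (replacePair f k (p, q)) (k + 1) (r, s)) k (t, u) = τ t u s := by
      intro p q r s t u
      funext i
      simp only [replacePair, τ]
      grind
    have hτ' : ∀ p q r s t u,
        replacePair (replacePair (replacePair f (k + 1) (p, q)) k (r, s)) (k + 1) (t, u) =
          τ r t u := by
      intro p q r s t u
      funext i
      simp only [replacePair, τ]
      grind
    simp only [site_mul_apply _ hk, site_mul_apply _ hk', Finset.mul_sum, Fintype.sum_prod_type,
      hτ, hτ']
    refine (sum_six_reorder_left _).trans (Eq.trans ?_ (sum_six_reorder_right _).symm)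
    refine Finset.sum_congr rfl fun t _ => Finset.sum_congr rfl fun u _ =>
      Finset.sum_congr rfl fun s _ => ?_
    have h₀ := congrArg (· * M (τ t u s) g)
      (hR.sum_eq (f ⟨k + 1 + 1, hk'⟩) (f ⟨k + 1, hk⟩) (f ⟨k, by omega⟩) t u s)
    simp only [Finset.sum_mul, mul_assoc] at h₀
    have h₁ : k + 1 + 1 ≠ k := by omega
    simpa [replacePair, PRmat, mul_assoc, h₁, h₁.symm] using h₀.symm
  simpa [mul_assoc] using key 1

end Site

section Metric

variable {n m : ℕ}

/-- The matrix of the order-reversing operator `v₁ ⊗ ⋯ ⊗ vₘ ↦ η vₘ ⊗ ⋯ ⊗ η v₁`. -/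
def revTensor (m : ℕ) (η : Matrix (Fin n) (Fin n) ℂ) :
    Matrix (Fin m → Fin n) (Fin m → Fin n) ℂ :=
  Matrix.of fun f g => ∏ t : Fin m, η (f t) (g t.rev)

theorem revTensor_inv_mul {η : Matrix (Fin n) (Fin n) ℂ} (hη : IsUnit η) :
    revTensor m η⁻¹ * revTensor m η = 1 := by
  ext f g
  have h : ∀ i j, ∑ a, η⁻¹ i a * η a j = (1 : Matrix (Fin n) (Fin n) ℂ) i j := by
    intro i j
    rw [← Matrix.mul_apply, Matrix.nonsing_inv_mul _ ((Matrix.isUnit_iff_isUnit_det _).mp hη)]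
  simp only [Matrix.mul_apply, revTensor, Matrix.of_apply]
  have hrev : ∀ e : Fin m → Fin n,
      (∏ t : Fin m, η⁻¹ (f t) (e t.rev)) * ∏ t : Fin m, η (e t) (g t.rev) =
        ∏ t : Fin m, η⁻¹ (f t.rev) (e t) * η (e t) (g t.rev) := by
    intro e
    rw [Finset.prod_mul_distrib, ← Equiv.prod_comp Fin.revPerm]
    simp
  simp only [hrev]
  rw [← Fintype.prod_sum fun (t : Fin m) (a : Fin n) => η⁻¹ (f t.rev) a * η a (g t.rev)]
  simp only [h, Matrix.one_apply]
  split_ifs with hfg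
  · simp [hfg]
  · obtain ⟨t, ht⟩ := Function.ne_iff.mp hfg
    refine Finset.prod_eq_zero (Finset.mem_univ t.rev) ?_
    simp [ht]

theorem prod_eq_pair_mul {k : ℕ} (h : k + 1 < m) (φ : Fin m → ℂ) :
    ∏ t, φ t = φ ⟨k, Nat.lt_of_succ_lt h⟩ * φ ⟨k + 1, h⟩ *
      ∏ t ∈ Finset.univ.filter fun t : Fin m => ¬(t.1 = k ∨ t.1 = k + 1), φ t := by
  rw [← Finset.prod_filter_mul_prod_filter_not Finset.univ fun t : Fin m => t.1 = k ∨ t.1 = k + 1]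
  congr 1
  rw [← Finset.prod_pair (by simp)]
  refine Finset.prod_congr ?_ fun _ _ => rfl
  ext t
  simp [Fin.ext_iff]

theorem site_mul_revTensor {R : Fin n → Fin n → Fin n → Fin n → ℂ}
    {η : Matrix (Fin n) (Fin n) ℂ} (hcov : MetricCovariant n R η) {k l : ℕ} (hkl : k + l + 2 = m) :
    site n m (PRmat n R) k * revTensor m η =
      revTensor m η * site n m (PRmat n R).transpose l := by
  have hk : k + 1 < m := by omega
  have hl : l + 1 < m := by omega
  ext f g
  rw [site_mul_apply _ hk, mul_site_apply _ hl]
  have hkr : Fin.rev ⟨k, Nat.lt_of_succ_lt hk⟩ = (⟨l + 1, hl⟩ : Fin m) := by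
    ext; simp only [Fin.val_rev]; omega
  have hkr' : Fin.rev ⟨k + 1, hk⟩ = (⟨l, Nat.lt_of_succ_lt hl⟩ : Fin m) := by
    ext; simp only [Fin.val_rev]; omega
  have hleft : ∀ p, revTensor m η (replacePair f k p) g =
      η p.1 (g ⟨l + 1, hl⟩) * η p.2 (g ⟨l, Nat.lt_of_succ_lt hl⟩) *
        ∏ t ∈ Finset.univ.filter fun t : Fin m => ¬(t.1 = k ∨ t.1 = k + 1), η (f t) (g t.rev) := by
    intro p
    rw [revTensor, Matrix.of_apply, prod_eq_pair_mul hk, hkr, hkr']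
    congr 1
    · simp [replacePair]
    · refine Finset.prod_congr rfl fun t ht => ?_
      have ht' := (Finset.mem_filter.mp ht).2
      rw [replacePair, if_neg (by tauto), if_neg (by tauto)]
  have hright : ∀ p, revTensor m η f (replacePair g l p) =
      η (f ⟨k, Nat.lt_of_succ_lt hk⟩) p.2 * η (f ⟨k + 1, hk⟩) p.1 *
        ∏ t ∈ Finset.univ.filter fun t : Fin m => ¬(t.1 = k ∨ t.1 = k + 1), η (f t) (g t.rev) := by
    intro p
    rw [revTensor, Matrix.of_apply, prod_eq_pair_mul hk, hkr, hkr']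
    congr 1
    · simp [replacePair]
    · refine Finset.prod_congr rfl fun t ht => ?_
      have ht' := (Finset.mem_filter.mp ht).2
      have h₁ : ¬ t.rev.1 = l := by simp only [Fin.val_rev]; omega
      have h₂ : ¬ t.rev.1 = l + 1 := by simp only [Fin.val_rev]; omega
      rw [replacePair, if_neg h₁, if_neg h₂]
  simp only [hleft, hright, ← mul_assoc]
  rw [← Finset.sum_mul]
  simp only [mul_right_comm _ (Finset.prod _ _)]
  rw [← Finset.sum_mul]
  congr 1
  have h := hcov (f ⟨k + 1, hk⟩) (f ⟨k, Nat.lt_of_succ_lt hk⟩) (g ⟨l + 1, hl⟩)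
    (g ⟨l, Nat.lt_of_succ_lt hl⟩)
  simp only [Fintype.sum_prod_type, PRmat, Matrix.transpose_apply, Matrix.of_apply]
  rw [← h]
  refine Finset.sum_congr rfl fun a _ => Finset.sum_congr rfl fun b _ => ?_
  ring

end Metric

theorem braidedFact_eq_ascFact (n m : ℕ) (R : Fin n → Fin n → Fin n → Fin n → ℂ) :
    braidedFact n m R = ascFact (site n m (PRmat n R)) (m - 1) := by
  have h := prod_ascSum_eq_ascFact (site n m (PRmat n R)) (le_refl (m - 1))
  simp only [Nat.sub_self, zero_add] at h
  rw [← h]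
  simp only [braidedFact, braidedInt, chain, Nat.sub_sub, add_comm 1, add_assoc, Nat.reduceAdd]

theorem RealTypeI.map_conj_PRmat {n : ℕ} {R : Fin n → Fin n → Fin n → Fin n → ℂ}
    (hreal : RealTypeI n R) : (PRmat n R).map (starRingEnd ℂ) = (PRmat n R).transpose := by
  ext p q
  exact hreal _ _ _ _

theorem braidedFact_mul_revTensor {n m : ℕ} {R : Fin n → Fin n → Fin n → Fin n → ℂ}
    (hR : QYBE n R) (hreal : RealTypeI n R) {η : Matrix (Fin n) (Fin n) ℂ}
    (hcov : MetricCovariant n R η) :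
    braidedFact n m R * revTensor m η =
      revTensor m η * (starRingEnd ℂ).mapMatrix (braidedFact n m R) := by
  rw [braidedFact_eq_ascFact, map_ascFact,
    ascFact_eq_descFact (m - 1) (fun k => (starRingEnd ℂ).mapMatrix (site n m (PRmat n R) k)),
    ← ascFact_reverse]
  · refine (semiconjBy_ascFact fun k hk => ?_).eq.symm
    rw [site_map_conj, hreal.map_conj_PRmat]
    exact (site_mul_revTensor hcov (by omega)).symm
  · intro i j hij
    exact (site_commute _ hij).map _
  · intro i hi
    simp only [← map_mul, site_braid hR (show i + 2 < m by omega)]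

/-- if `R` obeys the QYBE and is of real type I, and `η` is an
invertible `R`-covariant matrix with transposed-inverse entries
`η_{ij} = (η⁻¹) j i`, then for every `m ≥ 1`,
`conj(([m;R]!)^{j_1⋯j_m}_{i_1⋯i_m}) =
 Σ_{a,b} ([m;R]!)^{a_m⋯a_1}_{b_m⋯b_1} η_{a_1 j_1}⋯η_{a_m j_m}
 η^{b_m i_m}⋯η^{b_1 i_1}`. -/
theorem stmt16 (n : ℕ) (hn : 1 ≤ n)
    (R : Fin n → Fin n → Fin n → Fin n → ℂ) (hR : QYBE n R)
    (hreal : RealTypeI n R)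
    (η : Matrix (Fin n) (Fin n) ℂ) (hη : IsUnit η)
    (hcov : MetricCovariant n R η)
    (m : ℕ) (hm : 1 ≤ m) (j i : Fin m → Fin n) :
    conj (braidedFact n m R j i) =
      ∑ a : Fin m → Fin n, ∑ b : Fin m → Fin n,
        braidedFact n m R (fun t => a t.rev) (fun t => b t.rev) *
          (∏ t : Fin m, η⁻¹ (j t) (a t)) * (∏ t : Fin m, η (b t) (i t)) := by
  have hconj : (starRingEnd ℂ).mapMatrix (braidedFact n m R) =
      revTensor m η⁻¹ * (braidedFact n m R * revTensor m η) := by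
    rw [braidedFact_mul_revTensor hR hreal hcov, ← mul_assoc, revTensor_inv_mul hη, one_mul]
  have h := congrFun (congrFun hconj j) i
  rw [RingHom.mapMatrix_apply, Matrix.map_apply] at h
  rw [h]
  let e : (Fin m → Fin n) ≃ (Fin m → Fin n) := Fin.revPerm.arrowCongr (Equiv.refl _)
  simp only [Matrix.mul_apply, Finset.mul_sum]
  refine (Fintype.sum_equiv e _ _ fun a => Fintype.sum_equiv e _ _ fun b => ?_).symm
  have he : ∀ c, e c = fun t => c t.rev := fun c => rfl
  rw [he, he]
  simp only [revTensor, Matrix.of_apply, Fin.rev_rev]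
  rw [← Equiv.prod_comp Fin.revPerm fun t => η (b t.rev) (i t.rev)]
  simp only [Fin.revPerm_apply, Fin.rev_rev]
  ring
end
end
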